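/- Let Π = I_n − (1/n)J_n, where I_n is the n×n identity matrix and J_n the n×n all-ones matrix. Let U be a p×n real matrix with columns u_1,…,u_n ∈ ℝ^p such that, for some subset S ⊆ {1,…,n} and some real a > 0, Σ_{i∉S} ‖u_i‖₂ ≤ a·Σ_{i∈S} ‖u_i‖₂. Then ‖UΠ‖_F² ≥ (1 − (1+a)²|S|/n)·‖U‖_F². -/

import Mathlib

/-- Squared Euclidean norm on `ℝ^p`. -/
noncomputable def sqnorm {p : ℕ} (v : Fin p → ℝ) : ℝ := ∑ i, (v i) ^ 2

theorem sqrt_sqnorm_eq_norm {p : ℕ} (v : Fin p → ℝ) :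
    Real.sqrt (sqnorm v) = ‖WithLp.toLp 2 v‖ := by
  simp [EuclideanSpace.norm_eq, sqnorm]

theorem sqnorm_nonneg {p : ℕ} (v : Fin p → ℝ) : 0 ≤ sqnorm v :=
  Finset.sum_nonneg fun _ _ => sq_nonneg _

theorem sqrt_sqnorm_sum_le {ι : Type*} {p : ℕ} (s : Finset ι) (u : ι → Fin p → ℝ) :
    Real.sqrt (sqnorm (∑ i ∈ s, u i)) ≤ ∑ i ∈ s, Real.sqrt (sqnorm (u i)) := by
  simp only [sqrt_sqnorm_eq_norm, WithLp.toLp_sum]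
  exact norm_sum_le _ _

theorem sum_sub_mean_sq {n : ℕ} (x : Fin n → ℝ) :
    ∑ i, (x i - (n : ℝ)⁻¹ * ∑ k, x k) ^ 2 = ∑ i, x i ^ 2 - (n : ℝ)⁻¹ * (∑ k, x k) ^ 2 := by
  rcases Nat.eq_zero_or_pos n with rfl | hn
  · simp
  have hn' : (n : ℝ) ≠ 0 := by positivity
  simp only [sub_sq, Finset.sum_add_distrib, Finset.sum_sub_distrib, ← Finset.sum_mul,
    ← Finset.mul_sum, Finset.sum_const, Finset.card_univ, Fintype.card_fin, nsmul_eq_mul]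
  field_simp
  ring

theorem sum_sqnorm_sub_mean {p n : ℕ} (u : Fin n → Fin p → ℝ) :
    ∑ i, sqnorm (u i - (n : ℝ)⁻¹ • ∑ k, u k) =
      ∑ i, sqnorm (u i) - (n : ℝ)⁻¹ * sqnorm (∑ k, u k) := by
  simp only [sqnorm, Pi.sub_apply, Pi.smul_apply, Finset.sum_apply, smul_eq_mul]
  rw [Finset.sum_comm, Finset.sum_comm (f := fun i j => u i j ^ 2), Finset.mul_sum,
    ← Finset.sum_sub_distrib]
  exact Finset.sum_congr rfl fun j _ => sum_sub_mean_sq fun i => u i j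

/-- Lemma 6.1: let `Π = I_n - (1/n)J_n` and let `U` be a `p × n` matrix (given by its columns
`u_1, …, u_n`) such that `∑_{i∉S} ‖u_i‖₂ ≤ a ∑_{i∈S} ‖u_i‖₂` for some `S ⊆ [n]` and `a > 0`.
Then `‖UΠ‖_F² ≥ (1 - (1+a)²|S|/n) ‖U‖_F²`, where `(UΠ)_i = u_i - (1/n)∑_k u_k`. -/
theorem frobenius_proj_lower_bound (p n : ℕ) (u : Fin n → Fin p → ℝ)
    (S : Finset (Fin n)) (a : ℝ) (ha : 0 < a)
    (hcone : ∑ i ∈ Sᶜ, Real.sqrt (sqnorm (u i)) ≤ a * ∑ i ∈ S, Real.sqrt (sqnorm (u i))) :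
    (1 - (1 + a) ^ 2 * S.card / n) * ∑ i, sqnorm (u i) ≤
      ∑ i, sqnorm (u i - (n : ℝ)⁻¹ • ∑ k, u k) := by
  have hsum : Real.sqrt (sqnorm (∑ k, u k)) ≤ (1 + a) * ∑ i ∈ S, Real.sqrt (sqnorm (u i)) := by
    have h := sqrt_sqnorm_sum_le Finset.univ u
    rw [← Finset.sum_add_sum_compl S fun i => Real.sqrt (sqnorm (u i))] at h
    linarith
  have hcauchy : (∑ i ∈ S, Real.sqrt (sqnorm (u i))) ^ 2 ≤ S.card * ∑ i, sqnorm (u i) := by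
    refine sq_sum_le_card_mul_sum_sq.trans ?_
    simp only [Real.sq_sqrt (sqnorm_nonneg _)]
    gcongr
    · exact fun i _ _ => sqnorm_nonneg _
    · exact Finset.subset_univ S
  have hbound : sqnorm (∑ k, u k) ≤ (1 + a) ^ 2 * (S.card * ∑ i, sqnorm (u i)) := by
    rw [← Real.sq_sqrt (sqnorm_nonneg (∑ k, u k))]
    calc Real.sqrt (sqnorm (∑ k, u k)) ^ 2
        ≤ ((1 + a) * ∑ i ∈ S, Real.sqrt (sqnorm (u i))) ^ 2 := by gcongr
      _ ≤ _ := by rw [mul_pow]; gcongr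
  have hscaled := mul_le_mul_of_nonneg_left hbound (inv_nonneg.2 (Nat.cast_nonneg (α := ℝ) n))
  rw [sum_sqnorm_sub_mean, div_eq_mul_inv]
  linarith
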